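/- Let k be a positive odd integer and m = Σ_{−j≤i≤j} m_{i,j}⟨i,j⟩ a θ-restricted multisegment. Then in the B_θ(gl_∞)-module Ṽ_θ(0): E_k·P_θ(m)φ̃ = Σ_{ℓ>k} (1−q^2) q^{1+Σ_{ℓ'≥ℓ}(m_{k+2,ℓ'}−m_{k,ℓ'})}[m_{k+2,ℓ}+1] P_θ(m − ⟨k,ℓ⟩ + ⟨k+2,ℓ⟩)φ̃ + q^{1+Σ_{ℓ'>k}(m_{k+2,ℓ'}−m_{k,ℓ'}) − m_{k,k}} P_θ(m − ⟨k⟩)φ̃, and F_k·P_θ(m)φ̃ = Σ_{ℓ≥k} q^{Σ_{ℓ'>ℓ}(m_{k+2,ℓ'}−m_{k,ℓ'})}[m_{k,ℓ}+1] P_θ(m − δ_{ℓ≠k}⟨k+2,ℓ⟩ + ⟨k,ℓ⟩)φ̃, where all summation indices run over odd integers. -/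

import Mathlib

/-! `K = ℚ(q)` and the algebra `B_θ(gl_∞)`. -/

noncomputable section

/-- The base field `K = ℚ(q)`. -/
abbrev K : Type := RatFunc ℚ

/-- The indeterminate `q`. -/
def q : K := RatFunc.X

/-- The `q`-integer `[n]`. -/
def qint (n : ℤ) : K := (q ^ n - q ^ (-n)) / (q - q⁻¹)

/-- The `q`-factorial `[n]!`. -/
def qfact (n : ℕ) : K := ∏ k ∈ Finset.range n, qint (k + 1)

/-- Generators of `B_θ(gl_∞)`: `E_i`, `F_i`, `T_i`, `T_i⁻¹`; the parameter `a : ℤ`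
encodes the odd integer `i = 2a+1`. -/
inductive BGen : Type
  | E : ℤ → BGen
  | F : ℤ → BGen
  | T : ℤ → BGen
  | Tinv : ℤ → BGen

/-- Generators inside the free algebra. -/
def g (x : BGen) : FreeAlgebra K BGen := FreeAlgebra.ι K x

/-- The symmetric form `(α_i, α_j)` on the simple roots of `gl_∞`:
`2` if `i = j`, `−1` if `|i − j| = 2`, `0` otherwise. -/
def ip (i j : ℤ) : ℤ := if i = j then 2 else if (i - j).natAbs = 2 then -1 else 0

/-- The defining relations of `B_θ(gl_∞)` (with `θ(i) = −i`): the `T_i` commute and are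
invertible, `T_{−i} = T_i`, `T_i E_j T_i⁻¹ = q^{(α_i+α_{−i},α_j)} E_j`,
`T_i F_j T_i⁻¹ = q^{−(α_i+α_{−i},α_j)} F_j`,
`E_i F_j = q^{−(α_i,α_j)} F_j E_i + δ_{i,j} + δ_{−i,j} T_i`, and the `q`-Serre relations
for the `E_i`'s and for the `F_i`'s.  The parameter `a : ℤ` encodes `i = 2a+1`, so that
`θ` corresponds to `a ↦ −a−1`, `|i−j| > 2 ↔ 1 < |a−b|` and `|i−j| = 2 ↔ |a−b| = 1`. -/
inductive BRel : FreeAlgebra K BGen → FreeAlgebra K BGen → Prop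
  | Tcomm (a b : ℤ) : BRel (g (.T a) * g (.T b)) (g (.T b) * g (.T a))
  | TTinv (a : ℤ) : BRel (g (.T a) * g (.Tinv a)) 1
  | TinvT (a : ℤ) : BRel (g (.Tinv a) * g (.T a)) 1
  | Ttheta (a : ℤ) : BRel (g (.T (-a - 1))) (g (.T a))
  | TE (a b : ℤ) : BRel (g (.T a) * g (.E b) * g (.Tinv a))
      (q ^ (ip (2*a+1) (2*b+1) + ip (-(2*a+1)) (2*b+1)) • g (.E b))
  | TF (a b : ℤ) : BRel (g (.T a) * g (.F b) * g (.Tinv a))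
      (q ^ (-(ip (2*a+1) (2*b+1) + ip (-(2*a+1)) (2*b+1))) • g (.F b))
  | EF (a b : ℤ) : BRel (g (.E a) * g (.F b))
      (q ^ (-(ip (2*a+1) (2*b+1))) • (g (.F b) * g (.E a))
        + (if a = b then 1 else 0) + (if -a - 1 = b then g (.T a) else 0))
  | Efar (a b : ℤ) (h : 1 < |a - b|) : BRel (g (.E a) * g (.E b)) (g (.E b) * g (.E a))
  | Eserre (a b : ℤ) (h : |a - b| = 1) :
      BRel (g (.E a) * g (.E a) * g (.E b) + g (.E b) * (g (.E a) * g (.E a)))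
           ((q + q⁻¹) • (g (.E a) * g (.E b) * g (.E a)))
  | Ffar (a b : ℤ) (h : 1 < |a - b|) : BRel (g (.F a) * g (.F b)) (g (.F b) * g (.F a))
  | Fserre (a b : ℤ) (h : |a - b| = 1) :
      BRel (g (.F a) * g (.F a) * g (.F b) + g (.F b) * (g (.F a) * g (.F a)))
           ((q + q⁻¹) • (g (.F a) * g (.F b) * g (.F a)))

/-- The algebra `B_θ(gl_∞)`. -/
abbrev U : Type := RingQuot BRel

/-- The generator `E_i` for an odd integer `i`. -/
def Ee (i : ℤ) : U := RingQuot.mkAlgHom K BRel (g (.E ((i - 1) / 2)))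

/-- The generator `F_i` for an odd integer `i`; this is also the image of
`f_i ∈ U_q^-(gl_∞)` under `f_i ↦ F_i`. -/
def fgen (i : ℤ) : U := RingQuot.mkAlgHom K BRel (g (.F ((i - 1) / 2)))

/-- The generator `T_i` for an odd integer `i`. -/
def Tt (i : ℤ) : U := RingQuot.mkAlgHom K BRel (g (.T ((i - 1) / 2)))

/-- `segAux i n` is the segment `⟨i, i+2n⟩` (built from the `F` generators). -/
def segAux (i : ℤ) : ℕ → U
  | 0 => fgen i
  | n + 1 => segAux i n * fgen (i + 2 * (n + 1)) - q • (fgen (i + 2 * (n + 1)) * segAux i n)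

/-- The segment `⟨i,j⟩` for odd `i ≤ j`. -/
def seg (i j : ℤ) : U := segAux i ((j - i) / 2).toNat

/-- The divided power `⟨i,j⟩^{(n)}` (zero for `n < 0`). -/
def segPow (i j : ℤ) (n : ℤ) : U :=
  if n < 0 then 0 else (qfact n.toNat)⁻¹ • seg i j ^ n.toNat

/-- The modified divided power `⟨i,j⟩^{[n]}`. -/
def segPowM (i j : ℤ) (n : ℤ) : U :=
  if i = -j then
    (if n < 0 then 0 else (∏ ν ∈ Finset.range n.toNat, qint (2 * (ν + 1)))⁻¹ • seg i j ^ n.toNat)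
  else segPow i j n

open scoped Classical

/-- Multisegments as elements of the free abelian group on the segments `⟨i,j⟩`. -/
abbrev MS : Type := (ℤ × ℤ) →₀ ℤ

/-- The segment `⟨i,j⟩` viewed as a multisegment. -/
def sg (i j : ℤ) : MS := Finsupp.single (i, j) 1

/-- `m` is a multisegment: supported on pairs of odd integers `i ≤ j`,
with nonnegative multiplicities. -/
def IsMulti (m : MS) : Prop :=
  ∀ i j : ℤ, m (i, j) ≠ 0 → Odd i ∧ Odd j ∧ i ≤ j ∧ 0 < m (i, j)

/-- `m` is a θ-restricted multisegment (`m_{i,j} = 0` unless `−j ≤ i ≤ j`). -/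
def IsTheta (m : MS) : Prop :=
  ∀ i j : ℤ, m (i, j) ≠ 0 → Odd i ∧ Odd j ∧ -j ≤ i ∧ i ≤ j ∧ 0 < m (i, j)

/-- The pairs `(i,j)` in the box `[-N,N]²`, listed in decreasing PBW order,
i.e. decreasing lexicographic order in `(j,i)`. -/
def box (N : ℕ) : List (ℤ × ℤ) :=
  (List.range (2 * N + 1)).flatMap fun a =>
    (List.range (2 * N + 1)).map fun b => (((N : ℤ) - b, (N : ℤ) - a))

/-- A bound on the support of `m`. -/
def bound (m : MS) : ℕ := m.support.sup fun p => max p.1.natAbs p.2.natAbs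

/-- The product of the modified divided powers `⟨i,j⟩^{[m_{i,j}]}` over the segments
appearing in `m`, in decreasing PBW order. -/
def PthetaProd (m : MS) : U := ((box (bound m)).map fun p => segPowM p.1 p.2 (m p)).prod

/-- `P_θ(m)` for a θ-restricted multisegment `m`; it is `0` if `m` is not a
θ-restricted multisegment. -/
def Ptheta (m : MS) : U := if IsTheta m then PthetaProd m else 0

/-- The left ideal `Σ_i (B_θ(gl_∞)E_i + B_θ(gl_∞)(T_i − 1) + B_θ(gl_∞)(F_i − F_{−i}))`
(over odd `i`). -/
def Jideal : Ideal U := Ideal.span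
  {x : U | ∃ i : ℤ, Odd i ∧ (x = Ee i ∨ x = Tt i - 1 ∨ x = fgen i - fgen (-i))}

/-- The `B_θ(gl_∞)`-module `Ṽ_θ(0)`. -/
abbrev Vt : Type := U ⧸ Jideal

/-- The generator `φ̃ ∈ Ṽ_θ(0)`, image of `1`. -/
def phi : Vt := Submodule.Quotient.mk 1

theorem q_ne_zero : q ≠ 0 := RatFunc.X_ne_zero

theorem q_pow_ne_one {n : ℕ} (hn : n ≠ 0) : q ^ n ≠ 1 := by
  intro h
  have h' : (algebraMap (Polynomial ℚ) K) (Polynomial.X ^ n) = algebraMap (Polynomial ℚ) K 1 := by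
    rw [map_pow, RatFunc.algebraMap_X, map_one]
    exact h
  have h2 := congrArg Polynomial.natDegree (RatFunc.algebraMap_injective ℚ h')
  simp at h2
  exact hn h2

theorem q_sq_sub_one_ne_zero : q ^ 2 - 1 ≠ 0 :=
  sub_ne_zero.2 (q_pow_ne_one two_ne_zero)

theorem q_sub_inv_ne_zero : q - q⁻¹ ≠ 0 := by
  have h : q - q⁻¹ = (q ^ 2 - 1) * q⁻¹ := by
    have := q_ne_zero
    field_simp
  rw [h]
  exact mul_ne_zero q_sq_sub_one_ne_zero (inv_ne_zero q_ne_zero)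

theorem q_add_inv_ne_zero : q + q⁻¹ ≠ 0 := by
  have h : (q + q⁻¹) * (q * (q ^ 2 - 1)) = q ^ 4 - 1 := by
    have := q_ne_zero
    field_simp
    ring
  intro h0
  rw [h0, zero_mul] at h
  exact q_pow_ne_one four_ne_zero (sub_eq_zero.1 h.symm)

theorem qint_natCast_ne_zero {n : ℕ} (hn : n ≠ 0) : qint n ≠ 0 := by
  have h : q ^ (n : ℤ) - q ^ (-(n : ℤ)) = (q ^ (2 * n) - 1) * q ^ (-(n : ℤ)) := by
    have := q_ne_zero
    rw [sub_mul, one_mul, zpow_neg, zpow_natCast, mul_comm 2 n, pow_mul]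
    field_simp
  refine div_ne_zero ?_ q_sub_inv_ne_zero
  rw [h]
  exact mul_ne_zero (sub_ne_zero.2 (q_pow_ne_one (by omega))) (zpow_ne_zero _ q_ne_zero)

theorem qfact_succ (n : ℕ) : qfact (n + 1) = qfact n * qint (n + 1) :=
  Finset.prod_range_succ _ _

theorem qint_zero : qint 0 = 0 := by simp [qint]

theorem qint_add_one (n : ℤ) : qint (n + 1) = q ^ n + q⁻¹ * qint n := by
  have h1 := q_sub_inv_ne_zero
  have h0 := q_ne_zero
  unfold qint
  rw [div_eq_iff h1, add_mul, mul_assoc, div_mul_cancel₀ _ h1, neg_add, zpow_add₀ h0,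
    zpow_add₀ h0, zpow_neg_one, zpow_one]
  ring

theorem qint_add_one' (n : ℤ) : qint (n + 1) = q ^ (-n) + q * qint n := by
  have h1 := q_sub_inv_ne_zero
  have h0 := q_ne_zero
  unfold qint
  rw [div_eq_iff h1, add_mul, mul_assoc, div_mul_cancel₀ _ h1, neg_add, zpow_add₀ h0,
    zpow_add₀ h0, zpow_neg_one, zpow_one]
  ring

section Relations

theorem fgen_comm {i j : ℤ} (hi : Odd i) (hj : Odd j) (h : 2 < |i - j|) :
    fgen i * fgen j = fgen j * fgen i := by
  obtain ⟨a, rfl⟩ := hi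
  obtain ⟨b, rfl⟩ := hj
  have hab : 1 < |a - b| := by
    rw [show 2 * a + 1 - (2 * b + 1) = 2 * (a - b) by ring, abs_mul] at h
    norm_num at h
    exact h
  simpa [fgen] using RingQuot.mkAlgHom_rel K (BRel.Ffar a b hab)

theorem fgen_serre {i j : ℤ} (hi : Odd i) (hj : Odd j) (h : |i - j| = 2) :
    fgen i * fgen i * fgen j + fgen j * (fgen i * fgen i) =
      (q + q⁻¹) • (fgen i * fgen j * fgen i) := by
  obtain ⟨a, rfl⟩ := hi
  obtain ⟨b, rfl⟩ := hj
  have hab : |a - b| = 1 := by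
    rw [show 2 * a + 1 - (2 * b + 1) = 2 * (a - b) by ring, abs_mul] at h
    norm_num at h
    exact h
  simpa [fgen] using RingQuot.mkAlgHom_rel K (BRel.Fserre a b hab)

theorem Ee_mul_fgen {i j : ℤ} (hi : Odd i) (hj : Odd j) :
    Ee i * fgen j = q ^ (-(ip i j)) • (fgen j * Ee i)
      + (if i = j then 1 else 0) + (if -i = j then Tt i else 0) := by
  obtain ⟨a, rfl⟩ := hi
  obtain ⟨b, rfl⟩ := hj
  have h := RingQuot.mkAlgHom_rel K (BRel.EF a b)
  have h1 : (2 * a + 1 = 2 * b + 1) ↔ a = b := by omega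
  have h2 : (-(2 * a + 1) = 2 * b + 1) ↔ -a - 1 = b := by omega
  simp only [h1, h2]
  have e (c : ℤ) : (2 * c + 1 - 1) / 2 = c := by omega
  simp only [map_mul, map_add, map_smul, apply_ite (RingQuot.mkAlgHom K BRel), map_one,
    map_zero] at h
  simp only [fgen, Ee, Tt, e]
  exact h

theorem Tt_mul_fgen {i j : ℤ} (hi : Odd i) (hj : Odd j) :
    Tt i * fgen j = q ^ (-(ip i j + ip (-i) j)) • (fgen j * Tt i) := by
  obtain ⟨a, rfl⟩ := hi
  obtain ⟨b, rfl⟩ := hj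
  have h := RingQuot.mkAlgHom_rel K (BRel.TF a b)
  have h1 := RingQuot.mkAlgHom_rel K (BRel.TinvT a)
  have h2 := congrArg (· * RingQuot.mkAlgHom K BRel (g (.T a))) h
  simp only [map_mul, map_smul, map_one] at h1 h2
  rw [mul_assoc, h1, mul_one, smul_mul_assoc] at h2
  simpa [fgen, Tt] using h2

end Relations

section Brackets

variable {R A : Type*} [Field R] [Ring A] [Algebra R A]

theorem bracket_assoc {v : R} {f y f' : A} (h : f * f' = f' * f) :
    (f * y - v • (y * f)) * f' - v • (f' * (f * y - v • (y * f))) =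
      f * (y * f' - v • (f' * y)) - v • ((y * f' - v • (f' * y)) * f) := by
  have h' (z : A) : f * (f' * z) = f' * (f * z) := by rw [← mul_assoc, h, mul_assoc]
  simp only [mul_sub, sub_mul, smul_mul_assoc, mul_smul_comm, mul_assoc, h, h']
  module

theorem mul_bracket_of_smul_comm {x y z : A} {v a b : R} (hy : x * y = a • (y * x))
    (hz : x * z = b • (z * x)) :
    x * (y * z - v • (z * y)) = (a * b) • ((y * z - v • (z * y)) * x) := by
  have hy' (w : A) : x * (y * w) = a • (y * (x * w)) := by
    rw [← mul_assoc, hy, smul_mul_assoc, mul_assoc]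
  have hz' (w : A) : x * (z * w) = b • (z * (x * w)) := by
    rw [← mul_assoc, hz, smul_mul_assoc, mul_assoc]
  simp only [mul_sub, sub_mul, smul_mul_assoc, mul_smul_comm, mul_assoc, hy, hz, hy', hz']
  module

theorem mul_bracket_of_serre {v : R} (h0 : v ≠ 0) {f f' : A}
    (h : f * f * f' + f' * (f * f) = (v + v⁻¹) • (f * f' * f)) :
    f * (f * f' - v • (f' * f)) = v⁻¹ • ((f * f' - v • (f' * f)) * f) := by
  rw [mul_sub, sub_mul, mul_smul_comm, smul_mul_assoc, smul_sub, smul_smul,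
    inv_mul_cancel₀ h0, one_smul]
  rw [← sub_eq_zero] at h ⊢
  rw [← h, add_smul]
  simp only [mul_assoc]
  abel

theorem bracket_mul_of_serre {v : R} (h0 : v ≠ 0) {f f' : A}
    (h : f' * f' * f + f * (f' * f') = (v + v⁻¹) • (f' * f * f')) :
    (f * f' - v • (f' * f)) * f' = v⁻¹ • (f' * (f * f' - v • (f' * f))) := by
  rw [mul_sub, sub_mul, mul_smul_comm, smul_mul_assoc, smul_sub, smul_smul,
    inv_mul_cancel₀ h0, one_smul]
  rw [← sub_eq_zero] at h ⊢
  rw [← h, add_smul]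
  simp only [mul_assoc]
  abel

theorem middle_comm_of_serre {v : R} (h0 : v ≠ 0) (h2 : v + v⁻¹ ≠ 0) {x f y : A}
    (hxy : x * y = y * x)
    (hx : f * f * x + x * (f * f) = (v + v⁻¹) • (f * x * f))
    (hy : f * f * y + y * (f * f) = (v + v⁻¹) • (f * y * f)) :
    f * ((x * f - v • (f * x)) * y - v • (y * (x * f - v • (f * x)))) =
      ((x * f - v • (f * x)) * y - v • (y * (x * f - v • (f * x)))) * f := by
  have hq : (v + v⁻¹) * v = 1 + v ^ 2 := by field_simp; ring
  have hxy' (z : A) : y * (x * z) = x * (y * z) := by rw [← mul_assoc, ← hxy, mul_assoc]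
  have e1 : (v + v⁻¹) • (f * (x * (f * y))) = f * (f * (x * y)) + x * (f * (f * y)) := by
    have := congrArg (· * y) hx
    simpa only [add_mul, mul_assoc, smul_mul_assoc] using this.symm
  have e2 : (v + v⁻¹) • (x * (f * (y * f))) = x * (f * (f * y)) + x * (y * (f * f)) := by
    have := congrArg (x * ·) hy
    simpa only [mul_add, mul_assoc, mul_smul_comm] using this.symm
  have e3 : (v + v⁻¹) • (f * (y * (f * x))) = f * (f * (x * y)) + y * (f * (f * x)) := by
    have := congrArg (· * x) hy
    simpa only [add_mul, mul_assoc, smul_mul_assoc, ← hxy] using this.symm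
  have e4 : (v + v⁻¹) • (y * (f * (x * f))) = y * (f * (f * x)) + x * (y * (f * f)) := by
    have := congrArg (y * ·) hx
    simpa only [mul_add, mul_assoc, mul_smul_comm, hxy'] using this.symm
  apply smul_right_injective A h2
  rw [← sub_eq_zero]
  simp only [mul_sub, sub_mul, smul_mul_assoc, mul_smul_comm, mul_assoc, hxy', smul_sub]
  have hsm (c : R) (w : A) : (v + v⁻¹) • c • w = c • (v + v⁻¹) • w := smul_comm _ _ _
  simp only [hsm, e1, e2, e3, e4]
  have hq' (w : A) : v • (v + v⁻¹) • w = w + (v * v) • w := by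
    rw [smul_smul, mul_comm v, hq]; module
  simp only [hq']
  module

theorem mul_bracket_of_comm {v : R} {x y z : A} (hy : x * y = y * x) (hz : x * z = z * x) :
    x * (y * z - v • (z * y)) = (y * z - v • (z * y)) * x := by
  have h := mul_bracket_of_smul_comm (v := v) (a := 1) (b := 1)
    (hy.trans (one_smul R _).symm) (hz.trans (one_smul R _).symm)
  rwa [mul_one, one_smul] at h

theorem bracket_mul_bracket {v : R} {f f' y' : A} (hfar : f * y' = y' * f)
    (hy : (f' * y' - v • (y' * f')) * y' = v⁻¹ • (y' * (f' * y' - v • (y' * f'))))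
    (hmid : f' * (f * (f' * y' - v • (y' * f')) - v • ((f' * y' - v • (y' * f')) * f)) =
      (f * (f' * y' - v • (y' * f')) - v • ((f' * y' - v • (y' * f')) * f)) * f') :
    (f * (f' * y' - v • (y' * f')) - v • ((f' * y' - v • (y' * f')) * f)) *
        (f' * y' - v • (y' * f')) =
      v⁻¹ • ((f' * y' - v • (y' * f')) *
        (f * (f' * y' - v • (y' * f')) - v • ((f' * y' - v • (y' * f')) * f))) := by
  obtain ⟨y, hyd⟩ : ∃ y, y = f' * y' - v • (y' * f') := ⟨_, rfl⟩
  rw [← hyd] at hy hmid ⊢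
  have h1 : (f * y - v • (y * f)) * y' = v⁻¹ • (y' * (f * y - v • (y * f))) := by
    have e1 : f * (y * y') = v⁻¹ • (y' * (f * y)) := by
      rw [hy, mul_smul_comm, ← mul_assoc, hfar, mul_assoc]
    have e2 : y * (f * y') = v⁻¹ • (y' * (y * f)) := by
      rw [hfar, ← mul_assoc, hy, smul_mul_assoc, mul_assoc]
    simp only [sub_mul, mul_sub, smul_mul_assoc, mul_smul_comm, mul_assoc, e1, e2]
    module
  obtain ⟨z, hzd⟩ : ∃ z, z = f * y - v • (y * f) := ⟨_, rfl⟩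
  rw [← hzd] at hmid h1 ⊢
  have h2 : z * (f' * y') = v⁻¹ • (f' * (y' * z)) := by
    rw [← mul_assoc, ← hmid, mul_assoc, h1, mul_smul_comm]
  have h3 : z * (y' * f') = v⁻¹ • (y' * (f' * z)) := by
    rw [← mul_assoc, h1, smul_mul_assoc, mul_assoc, hmid]
  rw [hyd]
  simp only [mul_sub, sub_mul, mul_smul_comm, smul_mul_assoc, h2, h3, mul_assoc]
  module

end Brackets

theorem odd_plus_two {i : ℤ} (hi : Odd i) : Odd (i + 2) := hi.add_even even_two

theorem odd_add_two_mul {i : ℤ} (hi : Odd i) (n : ℤ) : Odd (i + 2 * n) :=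
  hi.add_even (even_two_mul n)

theorem segAux_succ (i : ℤ) (n : ℕ) :
    segAux i (n + 1) =
      segAux i n * fgen (i + 2 * (n + 1)) - q • (fgen (i + 2 * (n + 1)) * segAux i n) :=
  rfl

theorem segAux_succ_left {i : ℤ} (hi : Odd i) (n : ℕ) :
    segAux i (n + 1) = fgen i * segAux (i + 2) n - q • (segAux (i + 2) n * fgen i) := by
  induction n with
  | zero => simp [segAux]
  | succ n ih =>
    have e : i + 2 * (((n + 1 : ℕ) : ℤ) + 1) = i + 2 + 2 * (n + 1) := by push_cast; ring
    rw [segAux_succ, ih, segAux_succ (i + 2) n, e]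
    refine bracket_assoc (fgen_comm hi ?_ ?_)
    · exact odd_add_two_mul (odd_plus_two hi) _
    · rw [lt_abs]; right; omega

theorem fgen_mul_segAux_far {k i : ℤ} (hk : Odd k) (hi : Odd i) (n : ℕ)
    (h : k + 2 < i ∨ i + 2 * n + 2 < k) : fgen k * segAux i n = segAux i n * fgen k := by
  induction n with
  | zero => exact fgen_comm hk hi (by rw [lt_abs]; omega)
  | succ n ih =>
    have h1 := ih (by push_cast at h; omega)
    have h2 : fgen k * fgen (i + 2 * (n + 1)) = fgen (i + 2 * (n + 1)) * fgen k :=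
      fgen_comm hk (odd_add_two_mul hi _) (by push_cast at h; rw [lt_abs]; omega)
    rw [segAux_succ]
    exact mul_bracket_of_comm h1 h2

theorem fgen_mul_segAux_start {k : ℤ} (hk : Odd k) (n : ℕ) :
    fgen k * segAux k (n + 1) = q⁻¹ • (segAux k (n + 1) * fgen k) := by
  induction n with
  | zero =>
    refine mul_bracket_of_serre q_ne_zero (fgen_serre hk (odd_add_two_mul hk _) ?_)
    norm_num
  | succ n ih =>
    rw [segAux_succ]
    have h2 : fgen k * fgen (k + 2 * ((n + 1 : ℕ) + 1)) =
        fgen (k + 2 * ((n + 1 : ℕ) + 1)) * fgen k :=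
      fgen_comm hk (odd_add_two_mul hk _) (by push_cast; rw [lt_abs]; omega)
    have h := mul_bracket_of_smul_comm (v := q) (b := (1 : K)) ih (h2.trans (one_smul K _).symm)
    rwa [mul_one] at h

theorem fgen_mul_segAux_middle {i : ℤ} (hi : Odd i) (p n : ℕ) :
    fgen (i + 2 * p + 2) * segAux i (p + n + 2) = segAux i (p + n + 2) * fgen (i + 2 * p + 2) := by
  induction p generalizing i with
  | zero =>
    rw [zero_add]
    induction n with
    | zero =>
      have h1 : Odd (i + 2) := odd_plus_two hi
      have h2 : Odd (i + 4) := hi.add_even (by decide)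
      have e : segAux i 2 = (fgen i * fgen (i + 2) - q • (fgen (i + 2) * fgen i)) * fgen (i + 4)
          - q • (fgen (i + 4) * (fgen i * fgen (i + 2) - q • (fgen (i + 2) * fgen i))) := by
        simp [segAux]
      simp only [Nat.cast_zero, mul_zero, add_zero, zero_add, e]
      refine middle_comm_of_serre q_ne_zero q_add_inv_ne_zero (fgen_comm hi h2 ?_)
        (fgen_serre h1 hi ?_) (fgen_serre h1 h2 ?_)
        <;> ring_nf <;> norm_num
    | succ n ih =>
      rw [show n + 1 + 2 = (n + 2) + 1 by ring, segAux_succ]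
      have h2 : fgen (i + 2 * (0 : ℕ) + 2) * fgen (i + 2 * ((n + 2 : ℕ) + 1)) =
          fgen (i + 2 * ((n + 2 : ℕ) + 1)) * fgen (i + 2 * (0 : ℕ) + 2) :=
        fgen_comm (odd_plus_two (odd_add_two_mul hi _)) (odd_add_two_mul hi _)
          (by push_cast; rw [lt_abs]; omega)
      exact mul_bracket_of_comm ih h2
  | succ p ih =>
    have h1 := ih (odd_plus_two hi)
    have e : i + 2 + 2 * (p : ℤ) + 2 = i + 2 * (p + 1 : ℕ) + 2 := by push_cast; ring
    rw [e] at h1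
    have h2 : fgen (i + 2 * (p + 1 : ℕ) + 2) * fgen i = fgen i * fgen (i + 2 * (p + 1 : ℕ) + 2) :=
      fgen_comm (odd_plus_two (odd_add_two_mul hi _)) hi (by push_cast; rw [lt_abs]; omega)
    rw [show p + 1 + n + 2 = (p + n + 2) + 1 by ring, segAux_succ_left hi]
    exact mul_bracket_of_comm h2 h1

theorem segAux_mul_segAux_step {k : ℤ} (hk : Odd k) (n : ℕ) :
    segAux k (n + 1) * segAux (k + 2) n = q⁻¹ • (segAux (k + 2) n * segAux k (n + 1)) := by
  induction n generalizing k with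
  | zero =>
    have e : segAux k (0 + 1) = fgen k * fgen (k + 2) - q • (fgen (k + 2) * fgen k) := by
      simp [segAux]
    rw [e]
    refine bracket_mul_of_serre q_ne_zero (fgen_serre (odd_plus_two hk) hk ?_)
    norm_num
  | succ n ih =>
    have ih' := ih (odd_plus_two hk)
    have hfar := fgen_mul_segAux_far hk (odd_plus_two (odd_plus_two hk)) n (Or.inl (by omega))
    have hmid := fgen_mul_segAux_middle hk 0 n
    simp only [Nat.cast_zero, mul_zero, add_zero, zero_add] at hmid
    rw [segAux_succ_left hk (n + 1)]
    rw [segAux_succ_left hk (n + 1)] at hmid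
    rw [segAux_succ_left (odd_plus_two hk) n] at hmid ih' ⊢
    exact bracket_mul_bracket hfar ih' hmid

/-- The form `(α_k, ·)` is the difference `u_k(i) - u_k(i + 2)` of this function. -/
def ipAux (k i : ℤ) : ℤ := (if i = k then 1 else 0) - (if i = k + 2 then 1 else 0)

theorem ip_eq_ipAux_sub {k i : ℤ} (hk : Odd k) (hi : Odd i) :
    ip k i = ipAux k i - ipAux k (i + 2) := by
  obtain ⟨a, rfl⟩ := hk
  obtain ⟨b, rfl⟩ := hi
  unfold ip ipAux
  split_ifs <;> omega

/-- The correction term when `E_k` is moved past the segment `⟨k, k + 2n⟩`. -/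
def eCorr (k : ℤ) : ℕ → U
  | 0 => 1
  | n + 1 => (1 - q ^ 2) • segAux (k + 2) n

theorem Tt_mul_segAux {k i : ℤ} (hk : Odd k) (hi : Odd i) (n : ℕ) :
    Tt k * segAux i n =
      q ^ (-((ipAux k i - ipAux k (i + 2 * n + 2)) +
        (ipAux (-k) i - ipAux (-k) (i + 2 * n + 2)))) • (segAux i n * Tt k) := by
  induction n with
  | zero =>
    have h := Tt_mul_fgen hk hi
    rw [ip_eq_ipAux_sub hk hi, ip_eq_ipAux_sub hk.neg hi] at h
    simpa [segAux] using h
  | succ n ih =>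
    have hj : Odd (i + 2 * ((n : ℤ) + 1)) := odd_add_two_mul hi _
    have h := Tt_mul_fgen hk hj
    rw [ip_eq_ipAux_sub hk hj, ip_eq_ipAux_sub hk.neg hj] at h
    rw [segAux_succ, mul_bracket_of_smul_comm ih h, ← zpow_add₀ q_ne_zero]
    congr 2
    push_cast
    ring_nf

section Brackets

variable {R A : Type*} [Field R] [Ring A] [Algebra R A]

theorem mul_bracket_of_derivation_left {v b : R} {E f y : A} (hy : E * y = v • (y * E))
    (hf : E * f = b • (f * E) + 1) :
    E * (f * y - v • (y * f)) =
      (v * b) • ((f * y - v • (y * f)) * E) + (1 - v ^ 2) • y := by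
  have hy' (w : A) : E * (y * w) = v • (y * (E * w)) := by
    rw [← mul_assoc, hy, smul_mul_assoc, mul_assoc]
  have hf' (w : A) : E * (f * w) = b • (f * (E * w)) + w := by
    rw [← mul_assoc, hf, add_mul, smul_mul_assoc, mul_assoc, one_mul]
  simp only [mul_sub, sub_mul, smul_mul_assoc, mul_smul_comm, mul_assoc, hy, hf, hy', hf',
    mul_add, mul_one]
  module

theorem mul_bracket_of_derivation_right {v a b : R} {E f y D T : A}
    (hy : E * y = a • (y * E) + D) (hf : E * f = b • (f * E) + T)
    (hT : T * y = (v * a) • (y * T)) (hD : b • (f * D) = v • (D * f)) :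
    E * (f * y - v • (y * f)) = (b * a) • ((f * y - v • (y * f)) * E) := by
  have hy' (w : A) : E * (y * w) = a • (y * (E * w)) + D * w := by
    rw [← mul_assoc, hy, add_mul, smul_mul_assoc, mul_assoc]
  have hf' (w : A) : E * (f * w) = b • (f * (E * w)) + T * w := by
    rw [← mul_assoc, hf, add_mul, smul_mul_assoc, mul_assoc]
  simp only [mul_sub, sub_mul, smul_mul_assoc, mul_smul_comm, mul_assoc, hy, hf, hy', hf',
    mul_add, hT, smul_add, hD]
  module

end Brackets

theorem Ee_mul_segAux {k : ℤ} (hk : Odd k) (hk0 : 0 < k) (n : ℕ) {i : ℤ} (hi : Odd i)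
    (hj : 0 < i + 2 * n) :
    Ee k * segAux i n =
      q ^ (-(ipAux k i - ipAux k (i + 2 * n + 2))) • (segAux i n * Ee k) +
        (if i = k then eCorr k n else 0) := by
  induction n generalizing i with
  | zero =>
    have h := Ee_mul_fgen hk hi
    rw [ip_eq_ipAux_sub hk hi, if_neg (show ¬ -k = i by push_cast at hj; omega), add_zero] at h
    simpa [eCorr, segAux, eq_comm] using h
  | succ n ih =>
    have hi2 := odd_plus_two hi
    have e : i + 2 * ((n + 1 : ℕ) : ℤ) + 2 = i + 2 + 2 * n + 2 := by push_cast; ring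
    have hj' : 0 < i + 2 + 2 * (n : ℤ) := by push_cast at hj; linarith
    have hy := ih hi2 hj'
    have hf := Ee_mul_fgen hk hi
    rw [segAux_succ_left hi, e]
    rw [ip_eq_ipAux_sub hk hi] at hf
    by_cases hik : i = k
    · subst hik
      rw [if_pos rfl, if_neg (by omega), add_zero] at hf
      rw [if_neg (by omega), add_zero] at hy
      have ea : ipAux i (i + 2) - ipAux i (i + 2 + 2 * n + 2) = -1 := by
        unfold ipAux; split_ifs <;> omega
      rw [ea, neg_neg, zpow_one] at hy
      rw [if_pos rfl, mul_bracket_of_derivation_left hy hf, ← zpow_one_add₀ q_ne_zero, eCorr]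
      congr 3
      linarith
    · rw [if_neg (Ne.symm hik), add_zero] at hf
      rw [if_neg hik, add_zero]
      rw [mul_bracket_of_derivation_right hy hf, ← zpow_add₀ q_ne_zero]
      · congr 2
        ring
      · split_ifs with h
        · subst h
          have hT := Tt_mul_segAux hk hi2 n
          rw [hT, ← zpow_one_add₀ q_ne_zero]
          congr 2
          have : ipAux (-k) (-k + 2) - ipAux (-k) (-k + 2 + 2 * n + 2) = -1 := by
            unfold ipAux; split_ifs <;> omega
          linarith
        · simp
      · split_ifs with h
        · have eb : ipAux k i - ipAux k (i + 2) = -1 := by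
            unfold ipAux; split_ifs <;> omega
          rw [eb, neg_neg, zpow_one]
          congr 1
          cases n with
          | zero => simp [eCorr]
          | succ n =>
            simp only [eCorr, mul_smul_comm, smul_mul_assoc]
            rw [fgen_mul_segAux_far hi (odd_plus_two hk) n (by omega)]
        · simp

section PowerRules

variable {A : Type*} [Ring A] [Algebra K A]

theorem mul_pow_of_smul_comm {x y : A} {c : K} (h : x * y = c • (y * x)) (n : ℕ) :
    x * y ^ n = c ^ n • (y ^ n * x) := by
  induction n with
  | zero => simp
  | succ n ih =>
    rw [pow_succ y, ← mul_assoc, ih, smul_mul_assoc, mul_assoc, h, mul_smul_comm, smul_smul,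
      ← pow_succ, mul_assoc]

theorem mul_pow_of_derivation_right {x y z : A} (h : x * y = z + q • (y * x))
    (hz : z * y = q⁻¹ • (y * z)) (n : ℕ) :
    x * y ^ n = qint n • (y ^ (n - 1) * z) + q ^ n • (y ^ n * x) := by
  induction n with
  | zero => simp [qint_zero]
  | succ n ih =>
    have e : qint n • (y ^ (n - 1) * z * y) = (qint n * q⁻¹) • (y ^ n * z) := by
      cases n with
      | zero => simp [qint_zero]
      | succ n =>
        rw [mul_assoc, hz, mul_smul_comm, smul_smul, ← mul_assoc, Nat.add_sub_cancel, ← pow_succ]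
    rw [pow_succ y, ← mul_assoc, ih, add_mul, smul_mul_assoc, e, smul_mul_assoc, mul_assoc, h,
      mul_add, mul_smul_comm, ← mul_assoc, Nat.add_sub_cancel, smul_add, smul_smul,
      ← pow_succ, ← add_assoc, ← add_smul]
    push_cast
    rw [qint_add_one, zpow_natCast, add_comm, mul_comm (qint n), ← pow_succ, add_comm (q ^ n)]
    rw [add_comm]

theorem mul_pow_of_derivation_left {x y d : A} {c c' : K} (h : x * y = d + c • (y * x))
    (hd : y * d = c' • (d * y)) (hc : c * c' = q ^ (-2 : ℤ)) (n : ℕ) :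
    x * y ^ n = (q ^ (1 - n : ℤ) * qint n) • (d * y ^ (n - 1)) + c ^ n • (y ^ n * x) := by
  have hd' (n : ℕ) : y ^ n * d = c' ^ n • (d * y ^ n) := by
    induction n with
    | zero => simp
    | succ n ih =>
      rw [pow_succ', mul_assoc, ih, mul_smul_comm, ← mul_assoc, hd, smul_mul_assoc, smul_smul,
        ← pow_succ, mul_assoc]
  induction n with
  | zero => simp [qint_zero]
  | succ n ih =>
    have e : (q ^ (1 - n : ℤ) * qint n) • (d * y ^ (n - 1) * y) =
        (q ^ (1 - n : ℤ) * qint n) • (d * y ^ n) := by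
      cases n with
      | zero => simp [qint_zero]
      | succ n => rw [mul_assoc, Nat.add_sub_cancel, ← pow_succ]
    have h0 := q_ne_zero
    have hs : c ^ n * c' ^ n = q ^ (-(n : ℤ)) * q ^ (-(n : ℤ)) := by
      rw [← mul_pow, hc, ← zpow_natCast, ← zpow_mul, ← zpow_add₀ h0]
      congr 1
      ring
    rw [pow_succ y, ← mul_assoc, ih, add_mul, smul_mul_assoc, e, smul_mul_assoc, mul_assoc, h,
      mul_add, hd', mul_smul_comm, ← mul_assoc, smul_add, smul_smul, smul_smul, hs, ← pow_succ,
      ← pow_succ, Nat.add_sub_cancel, ← add_assoc, ← add_smul]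
    congr 2
    push_cast
    rw [qint_add_one', sub_eq_add_neg, zpow_add₀ h0, zpow_one, show (1 : ℤ) - (n + 1) = -n by ring]
    ring

theorem mul_prod_of_raise {x z X B B' C C' Y : A} {a b c : K} (hX : x * X = X * x)
    (hB : x * B = B' * z + a • (B * x)) (hz : z * C = c • C') (hC : x * C = b • (C * x))
    (hY : x * Y = Y * x) :
    x * (X * (B * (C * Y))) = (a * b) • (X * (B * (C * Y)) * x) + c • (X * (B' * (C' * Y))) := by
  rw [← mul_assoc x, hX, mul_assoc, ← mul_assoc x, hB, add_mul, smul_mul_assoc, mul_assoc B',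
    ← mul_assoc z, hz, mul_assoc B, ← mul_assoc x, hC]
  simp only [smul_mul_assoc, mul_smul_comm, mul_add, smul_smul, mul_assoc, hY]
  rw [add_comm]

theorem mul_prod_of_lower {x z X B B' C C' Y : A} {a b c d : K} (hX : x * X = X * x)
    (hB : x * B = a • (B * x)) (hC : x * C = d • (z * C') + b • (C * x)) (hz : B * z = c • B')
    (hY : x * Y = Y * x) :
    x * (X * (B * (C * Y))) =
      (a * b) • (X * (B * (C * Y)) * x) + (a * d * c) • (X * (B' * (C' * Y))) := by
  rw [← mul_assoc x, hX, mul_assoc, ← mul_assoc x, hB, smul_mul_assoc, mul_assoc B,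
    ← mul_assoc x, hC, add_mul]
  simp only [smul_mul_assoc, mul_smul_comm, mul_add, smul_smul, mul_assoc, hY, smul_add]
  rw [← mul_assoc B, hz, add_comm]
  simp only [smul_mul_assoc, mul_smul_comm, smul_smul, mul_assoc]

end PowerRules

section Segments

theorem seg_eq_segAux (i : ℤ) (n : ℕ) : seg i (i + 2 * n) = segAux i n := by
  unfold seg
  congr 1
  omega

theorem exists_nat_of_odd {i j : ℤ} (hi : Odd i) (hj : Odd j) (h : i ≤ j) :
    ∃ n : ℕ, j = i + 2 * n := by
  obtain ⟨a, rfl⟩ := hi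
  obtain ⟨b, rfl⟩ := hj
  exact ⟨(b - a).toNat, by omega⟩

theorem seg_self (k : ℤ) : seg k k = fgen k := by simpa [segAux] using seg_eq_segAux k 0

theorem exists_seg_eq {k j : ℤ} (hk : Odd k) (hj : Odd j) (h : k < j) :
    ∃ n : ℕ, j = k + 2 * n + 2 ∧ seg k j = segAux k (n + 1) ∧ seg (k + 2) j = segAux (k + 2) n := by
  obtain ⟨n, rfl⟩ := exists_nat_of_odd (odd_plus_two hk) hj (by
    obtain ⟨a, rfl⟩ := hk; obtain ⟨b, rfl⟩ := hj; omega)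
  refine ⟨n, by ring, ?_, seg_eq_segAux _ _⟩
  rw [← seg_eq_segAux]
  congr 1
  push_cast
  ring

theorem fgen_mul_seg_add_two {k j : ℤ} (hk : Odd k) (hj : Odd j) (h : k < j) :
    fgen k * seg (k + 2) j = seg k j + q • (seg (k + 2) j * fgen k) := by
  obtain ⟨n, -, h1, h2⟩ := exists_seg_eq hk hj h
  rw [h1, h2, segAux_succ_left hk, sub_add_cancel]

theorem fgen_mul_seg_start {k j : ℤ} (hk : Odd k) (hj : Odd j) (h : k < j) :
    fgen k * seg k j = q⁻¹ • (seg k j * fgen k) := by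
  obtain ⟨n, -, h1, -⟩ := exists_seg_eq hk hj h
  rw [h1, fgen_mul_segAux_start hk]

theorem seg_mul_seg_add_two {k j : ℤ} (hk : Odd k) (hj : Odd j) (h : k < j) :
    seg k j * seg (k + 2) j = q⁻¹ • (seg (k + 2) j * seg k j) := by
  obtain ⟨n, -, h1, h2⟩ := exists_seg_eq hk hj h
  rw [h1, h2, segAux_mul_segAux_step hk]

theorem fgen_mul_seg_comm {k i j : ℤ} (hk : Odd k) (hi : Odd i) (hj : Odd j) (hij : i ≤ j)
    (hkj : k < j) (h : i < k ∨ k + 2 < i) : fgen k * seg i j = seg i j * fgen k := by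
  obtain ⟨n, rfl⟩ := exists_nat_of_odd hi hj hij
  rw [seg_eq_segAux]
  rcases h with h | h
  · obtain ⟨p, rfl⟩ : ∃ p : ℕ, k = i + 2 * p + 2 := by
      obtain ⟨a, rfl⟩ := hi
      obtain ⟨b, rfl⟩ := hk
      exact ⟨(b - a - 1).toNat, by omega⟩
    obtain ⟨t, rfl⟩ : ∃ t, n = p + t + 2 := ⟨n - p - 2, by omega⟩
    exact fgen_mul_segAux_middle hi p t
  · exact fgen_mul_segAux_far hk hi n (Or.inl h)

theorem Ee_mul_seg {k i j : ℤ} (hk : Odd k) (hk0 : 0 < k) (hi : Odd i) (hj : Odd j)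
    (hij : i ≤ j) (hj0 : 0 < j) (hik : i ≠ k) :
    Ee k * seg i j = q ^ (-(ipAux k i - ipAux k (j + 2))) • (seg i j * Ee k) := by
  obtain ⟨n, rfl⟩ := exists_nat_of_odd hi hj hij
  rw [seg_eq_segAux, Ee_mul_segAux hk hk0 n hi hj0, if_neg hik, add_zero]

theorem Ee_mul_seg_start {k j : ℤ} (hk : Odd k) (hk0 : 0 < k) (hj : Odd j) (h : k < j) :
    Ee k * seg k j = (1 - q ^ 2) • seg (k + 2) j + q ^ (-1 : ℤ) • (seg k j * Ee k) := by
  obtain ⟨n, rfl, h1, h2⟩ := exists_seg_eq hk hj h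
  rw [h1, h2, Ee_mul_segAux hk hk0 _ hk (by omega), if_pos rfl, eCorr, add_comm]
  congr 3
  unfold ipAux
  split_ifs <;> omega

theorem Ee_mul_fgen_self {k : ℤ} (hk : Odd k) (hk0 : 0 < k) :
    Ee k * fgen k = 1 + q ^ (-2 : ℤ) • (fgen k * Ee k) := by
  rw [Ee_mul_fgen hk hk, if_pos rfl, if_neg (by omega), add_zero, add_comm]
  simp [ip]

end Segments

section DividedPowers

theorem segPow_of_neg {i j n : ℤ} (h : n < 0) : segPow i j n = 0 := if_pos h

theorem segPow_natCast (i j : ℤ) (n : ℕ) :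
    segPow i j n = (qfact n)⁻¹ • seg i j ^ n := by
  simp [segPow]

theorem segPowM_of_ne {i j : ℤ} (h : i ≠ -j) (n : ℤ) : segPowM i j n = segPow i j n := if_neg h

theorem segPowM_zero (i j : ℤ) : segPowM i j 0 = 1 := by
  simp [segPowM, segPow, qfact]

theorem seg_mul_segPow (i j : ℤ) (n : ℕ) :
    seg i j * segPow i j n = qint (n + 1) • segPow i j (n + 1) := by
  have h := qint_natCast_ne_zero (Nat.succ_ne_zero n)
  have h' := segPow_natCast i j (n + 1)
  push_cast at h h'
  rw [h', segPow_natCast, mul_smul_comm, ← pow_succ', qfact_succ, smul_smul, mul_inv,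
    mul_left_comm, mul_inv_cancel₀ h, mul_one]

theorem segPow_mul_seg (i j : ℤ) (n : ℕ) :
    segPow i j n * seg i j = qint (n + 1) • segPow i j (n + 1) := by
  rw [← seg_mul_segPow, segPow_natCast, smul_mul_assoc, mul_smul_comm, ← pow_succ, ← pow_succ']

theorem inv_qfact_smul_pow (i j : ℤ) (n : ℕ) :
    ((qfact n)⁻¹ * qint n) • seg i j ^ (n - 1) = segPow i j (n - 1) := by
  cases n with
  | zero =>
    rw [segPow_of_neg (by simp)]
    simp [qint_zero]
  | succ n =>
    have h := qint_natCast_ne_zero (Nat.succ_ne_zero n)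
    have e : (((n + 1 : ℕ) : ℤ) - 1) = n := by push_cast; ring
    rw [e, segPow_natCast, Nat.add_sub_cancel, qfact_succ]
    push_cast at h ⊢
    rw [mul_inv, mul_assoc, inv_mul_cancel₀ h, mul_one]

theorem mul_segPow_of_smul_comm {x : U} {i j : ℤ} {c : K} (h : x * seg i j = c • (seg i j * x))
    (n : ℕ) : x * segPow i j n = c ^ n • (segPow i j n * x) := by
  rw [segPow_natCast, mul_smul_comm, mul_pow_of_smul_comm h, smul_mul_assoc, smul_comm]

theorem mul_segPowM_of_smul_comm {x : U} {i j : ℤ} {c : K} (h : x * seg i j = c • (seg i j * x))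
    {n : ℤ} (hn : 0 ≤ n) : x * segPowM i j n = c ^ n • (segPowM i j n * x) := by
  lift n to ℕ using hn
  unfold segPowM
  split_ifs with h1 h2
  · simp
  · rw [mul_smul_comm, mul_pow_of_smul_comm (by simpa using h), smul_mul_assoc, smul_comm]
    simp
  · simpa using mul_segPow_of_smul_comm h n

theorem mul_segPow_of_derivation_right {x z : U} {i j : ℤ}
    (h : x * seg i j = z + q • (seg i j * x)) (hz : z * seg i j = q⁻¹ • (seg i j * z)) (n : ℕ) :
    x * segPow i j n = segPow i j (n - 1) * z + q ^ n • (segPow i j n * x) := by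
  rw [← inv_qfact_smul_pow, segPow_natCast, mul_smul_comm, mul_pow_of_derivation_right h hz,
    smul_add, smul_mul_assoc, smul_mul_assoc, smul_smul, smul_comm]

theorem mul_segPow_of_derivation_left {x d : U} {i j : ℤ} {c c' : K}
    (h : x * seg i j = d + c • (seg i j * x)) (hd : seg i j * d = c' • (d * seg i j))
    (hc : c * c' = q ^ (-2 : ℤ)) (n : ℕ) :
    x * segPow i j n =
      q ^ (1 - n : ℤ) • (d * segPow i j (n - 1)) + c ^ n • (segPow i j n * x) := by
  rw [← inv_qfact_smul_pow, segPow_natCast, mul_smul_comm, mul_pow_of_derivation_left h hd hc,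
    smul_add, smul_mul_assoc, mul_smul_comm]
  simp only [smul_smul]
  rw [mul_left_comm, mul_comm _ (c ^ n)]

end DividedPowers

/-- The product `f hi * f (hi - 1) * ⋯ * f (hi - n + 1)`. -/
def descProd {M : Type*} [Monoid M] (f : ℤ → M) (hi : ℤ) (n : ℕ) : M :=
  ((List.range n).map fun b : ℕ => f (hi - b)).prod

section DescProd

variable {M : Type*} [Monoid M]

theorem descProd_zero (f : ℤ → M) (hi : ℤ) : descProd f hi 0 = 1 := rfl

theorem descProd_succ (f : ℤ → M) (hi : ℤ) (n : ℕ) :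
    descProd f hi (n + 1) = descProd f hi n * f (hi - n) := by
  simp [descProd, List.range_succ]

theorem descProd_one (f : ℤ → M) (hi : ℤ) : descProd f hi 1 = f hi := by
  simp [descProd]

theorem descProd_add (f : ℤ → M) (hi : ℤ) (n p : ℕ) :
    descProd f hi (n + p) = descProd f hi n * descProd f (hi - n) p := by
  induction p with
  | zero => simp [descProd_zero]
  | succ p ih =>
    rw [← add_assoc, descProd_succ, ih, descProd_succ, mul_assoc]
    congr 3
    push_cast
    ring

theorem descProd_congr {f f' : ℤ → M} {hi : ℤ} {n : ℕ}
    (h : ∀ i, hi - n < i → i ≤ hi → f i = f' i) : descProd f hi n = descProd f' hi n := by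
  unfold descProd
  congr 1
  refine List.map_congr_left fun b hb => h _ ?_ ?_ <;> have := List.mem_range.1 hb <;> omega

theorem descProd_eq_one {f : ℤ → M} {hi : ℤ} {n : ℕ}
    (h : ∀ i, hi - n < i → i ≤ hi → f i = 1) : descProd f hi n = 1 := by
  rw [descProd_congr (f' := fun _ => 1) h]
  simp [descProd]

theorem descProd_extend {f : ℤ → M} {N d : ℕ} (h : ∀ i : ℤ, N < i.natAbs → f i = 1) :
    descProd f (N + d : ℕ) (2 * (N + d) + 1) = descProd f N (2 * N + 1) := by
  rw [show 2 * (N + d) + 1 = d + ((2 * N + 1) + d) by ring, descProd_add, descProd_add,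
    descProd_eq_one (n := d), descProd_eq_one (n := d), one_mul, mul_one]
  · congr 1
    push_cast
    ring
  · exact fun i h1 h2 => h i (by push_cast at h1 h2; omega)
  · exact fun i h1 h2 => h i (by push_cast at h1 h2; omega)

theorem mul_descProd_comm {f : ℤ → M} {hi : ℤ} {n : ℕ} {x : M}
    (h : ∀ i, hi - n < i → i ≤ hi → x * f i = f i * x) :
    x * descProd f hi n = descProd f hi n * x := by
  refine Commute.list_prod_right _ _ fun y hy => ?_
  obtain ⟨b, hb, rfl⟩ := List.mem_map.1 hy
  have := List.mem_range.1 hb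
  exact h _ (by omega) (by omega)

variable {A : Type*} [Ring A] [Algebra K A]

theorem exists_mul_descProd_smul_comm {f : ℤ → A} {hi : ℤ} {n : ℕ} {x : A}
    (h : ∀ i, hi - n < i → i ≤ hi → ∃ c : K, x * f i = c • (f i * x)) :
    ∃ c : K, x * descProd f hi n = c • (descProd f hi n * x) := by
  induction n with
  | zero => exact ⟨1, by simp [descProd_zero]⟩
  | succ n ih =>
    obtain ⟨c, hc⟩ := ih fun i h1 h2 => h i (by push_cast; omega) h2
    obtain ⟨c', hc'⟩ := h (hi - n) (by push_cast; omega) (by omega)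
    refine ⟨c * c', ?_⟩
    rw [descProd_succ, ← mul_assoc, hc, smul_mul_assoc, mul_assoc, hc', mul_smul_comm, smul_smul,
      mul_assoc]

theorem mul_descProd_eq_sum {w : ℤ → A} {w' : ℤ → ℤ → A} {c d : ℤ → K} {x : A} {hi : ℤ} {n : ℕ}
    (hx : ∀ j, hi - n < j → j ≤ hi → x * w j = c j • (w j * x) + d j • w' j j)
    (hw : ∀ l j, j ≠ l → w' l j = w j) :
    x * descProd w hi n =
      (∏ b ∈ Finset.range n, c (hi - b)) • (descProd w hi n * x) +
        ∑ a ∈ Finset.range n, (d (hi - a) * ∏ b ∈ Finset.range a, c (hi - b)) •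
          descProd (w' (hi - a)) hi n := by
  induction n with
  | zero => simp [descProd_zero]
  | succ n ih =>
    have ih := ih fun j h1 h2 => hx j (by push_cast; omega) h2
    have hn := hx (hi - n) (by push_cast; omega) (by omega)
    have e1 : descProd w hi n = descProd (w' (hi - n)) hi n :=
      descProd_congr fun i h1 _ => (hw _ _ (by omega)).symm
    rw [descProd_succ, ← mul_assoc, ih, add_mul, smul_mul_assoc, mul_assoc, hn,
      Finset.prod_range_succ, Finset.sum_range_succ, Finset.sum_mul, descProd_succ (w' (hi - n)),
      ← e1, mul_add, smul_add, mul_smul_comm, smul_smul, mul_smul_comm, smul_smul, ← mul_assoc,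
      add_assoc, mul_comm (d _)]
    congr 1
    rw [add_comm]
    congr 1
    refine Finset.sum_congr rfl fun a ha => ?_
    have := Finset.mem_range.1 ha
    rw [descProd_succ, smul_mul_assoc, hw _ _ (by omega)]

end DescProd

theorem IsTheta.nonneg {m : MS} (hm : IsTheta m) (i j : ℤ) : 0 ≤ m (i, j) := by
  by_contra h
  exact absurd (hm i j (by omega)).2.2.2.2 (by omega)

theorem IsTheta.eq_zero {m : MS} (hm : IsTheta m) {i j : ℤ}
    (h : ¬ (Odd i ∧ Odd j ∧ -j ≤ i ∧ i ≤ j)) : m (i, j) = 0 := by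
  by_contra h0
  obtain ⟨h1, h2, h3, h4, -⟩ := hm i j h0
  exact h ⟨h1, h2, h3, h4⟩

/-- The factor of `P_θ(m)` collecting the segments ending at `j` and starting in `[-N, N]`. -/
def row (m : MS) (N : ℕ) (j : ℤ) : U := descProd (fun i => segPowM i j (m (i, j))) N (2 * N + 1)

theorem row_congr {m m' : MS} {j : ℤ} (h : ∀ i, m (i, j) = m' (i, j)) (N : ℕ) :
    row m N j = row m' N j := by
  unfold row
  simp only [h]

theorem row_eq_one {m : MS} {j : ℤ} (h : ∀ i, m (i, j) = 0) (N : ℕ) : row m N j = 1 :=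
  descProd_eq_one fun i _ _ => by simp only [h, segPowM_zero]

theorem PthetaProd_eq (m : MS) :
    PthetaProd m = descProd (row m (bound m)) (bound m) (2 * bound m + 1) := by
  have hcast (l : List ℕ) : (do let a ← l; pure (a : ℤ)) = l.map (fun a : ℕ => (a : ℤ)) := by
    simp [List.map_eq_flatMap]
  unfold PthetaProd box descProd row descProd
  simp only [hcast, List.flatMap_def, List.map_flatten, List.prod_flatten, List.map_map,
    Function.comp_def]

theorem natAbs_le_bound {m : MS} {i j : ℤ} (h : m (i, j) ≠ 0) :
    i.natAbs ≤ bound m ∧ j.natAbs ≤ bound m := by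
  have := Finset.le_sup (f := fun p : ℤ × ℤ => max p.1.natAbs p.2.natAbs)
    (Finsupp.mem_support_iff.2 h)
  exact max_le_iff.1 this

theorem PthetaProd_eq_of_le {m : MS} {N : ℕ} (h : bound m ≤ N) :
    PthetaProd m = descProd (row m N) N (2 * N + 1) := by
  obtain ⟨d, rfl⟩ := Nat.exists_eq_add_of_le h
  have hz {i j : ℤ} (h : bound m < i.natAbs ∨ bound m < j.natAbs) : m (i, j) = 0 := by
    by_contra h0
    have := natAbs_le_bound h0
    omega
  have hr (j : ℤ) : row m (bound m + d) j = row m (bound m) j :=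
    descProd_extend fun i hi => by rw [hz (Or.inl hi), segPowM_zero]
  rw [PthetaProd_eq, ← descProd_extend (d := d)]
  · simp only [funext hr]
  · exact fun j hj => row_eq_one (fun i => hz (Or.inr hj)) _

theorem row_split {m : MS} {N n : ℕ} {k j : ℤ} (hk : 0 < k) (hj : 0 < j)
    (hN : (N : ℤ) = k + 2 + n)
    (hm : m (k + 1, j) = 0) :
    row m N j = descProd (fun i => segPowM i j (m (i, j))) N n *
      (segPow (k + 2) j (m (k + 2, j)) * (segPow k j (m (k, j)) *
        descProd (fun i => segPowM i j (m (i, j))) (k - 1) (N + k).toNat)) := by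
  have e : 2 * N + 1 = n + (1 + (1 + (1 + (N + k).toNat))) := by omega
  unfold row
  rw [e, descProd_add, descProd_add, descProd_add, descProd_add, descProd_one, descProd_one,
    descProd_one, show (N : ℤ) - n = k + 2 by omega, Nat.cast_one,
    show k + 2 - 1 = k + 1 by ring, show k + 1 - 1 = k by ring, hm, segPowM_zero, one_mul,
    segPowM_of_ne (by omega), segPowM_of_ne (by omega)]

theorem row_split_diag {m : MS} {N n : ℕ} {k : ℤ} (hk : 0 < k) (hN : (N : ℤ) = k + n)
    (hm : ∀ i, k < i → m (i, k) = 0) :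
    row m N k = segPow k k (m (k, k)) *
      descProd (fun i => segPowM i k (m (i, k))) (k - 1) (N + k).toNat := by
  have e : 2 * N + 1 = n + (1 + (N + k).toNat) := by omega
  unfold row
  rw [e, descProd_add, descProd_add, descProd_one, descProd_eq_one, one_mul,
    show (N : ℤ) - n = k by omega, segPowM_of_ne (by omega)]
  · rfl
  · exact fun i h1 _ => by rw [hm i (by omega), segPowM_zero]

theorem IsTheta.mul_descProd_comm {m : MS} (hm : IsTheta m) {x : U} {j hi : ℤ} {n : ℕ}
    (h : ∀ i, hi - n < i → i ≤ hi → Odd i → Odd j → -j ≤ i → i ≤ j → x * seg i j = seg i j * x) :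
    x * descProd (fun i => segPowM i j (m (i, j))) hi n =
      descProd (fun i => segPowM i j (m (i, j))) hi n * x := by
  refine _root_.mul_descProd_comm fun i h1 h2 => ?_
  by_cases h0 : m (i, j) = 0
  · rw [h0, segPowM_zero, mul_one, one_mul]
  · obtain ⟨h3, h4, h5, h6, h7⟩ := hm i j h0
    have := mul_segPowM_of_smul_comm (c := 1) ((h i h1 h2 h3 h4 h5 h6).trans (one_smul K _).symm)
      h7.le
    rwa [one_zpow, one_smul] at this

theorem IsTheta.exists_mul_descProd_smul_comm {m : MS} (hm : IsTheta m) {k j hi : ℤ} {n : ℕ}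
    (hk : Odd k) (hk0 : 0 < k) (h : ∀ i, hi - n < i → i ≤ hi → i ≤ j → i ≠ k) :
    ∃ c : K, Ee k * descProd (fun i => segPowM i j (m (i, j))) hi n =
      c • (descProd (fun i => segPowM i j (m (i, j))) hi n * Ee k) := by
  refine _root_.exists_mul_descProd_smul_comm fun i h1 h2 => ?_
  by_cases h0 : m (i, j) = 0
  · exact ⟨1, by rw [h0, segPowM_zero, mul_one, one_mul, one_smul]⟩
  · obtain ⟨h3, h4, h5, h6, h7⟩ := hm i j h0
    have hj : 0 < j := by
      obtain ⟨a, rfl⟩ := h4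
      omega
    exact ⟨_, mul_segPowM_of_smul_comm (Ee_mul_seg hk hk0 h3 h4 h6 hj (h i h1 h2 h6)) h7.le⟩

section RowRules

variable {k : ℤ} {m m' : MS} {N : ℕ}

theorem descProd_segPowM_congr {j hi : ℤ} {n : ℕ}
    (h : ∀ i, hi - n < i → i ≤ hi → m' (i, j) = m (i, j)) :
    descProd (fun i => segPowM i j (m' (i, j))) hi n =
      descProd (fun i => segPowM i j (m (i, j))) hi n :=
  descProd_congr fun i h1 h2 => by rw [h i h1 h2]

theorem IsTheta.even_eq_zero (hm : IsTheta m) (hk : Odd k) (j : ℤ) : m (k + 1, j) = 0 :=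
  hm.eq_zero fun h => by
    obtain ⟨a, rfl⟩ := hk
    obtain ⟨b, hb⟩ := h.1
    omega

theorem fgen_mul_row (hk : Odd k) (hk0 : 0 < k) (hm : IsTheta m) {j : ℤ} (hj : Odd j)
    (hkj : k < j) (hN : k + 2 ≤ N)
    (hm' : ∀ i, m' (i, j) = m (i, j) + (if i = k then 1 else 0) - (if i = k + 2 then 1 else 0)) :
    fgen k * row m N j = q ^ (m (k + 2, j) - m (k, j)) • (row m N j * fgen k) +
      qint (m (k, j) + 1) • row m' N j := by
  obtain ⟨n, hn⟩ : ∃ n : ℕ, (N : ℤ) = k + 2 + n := ⟨(N - k - 2).toNat, by omega⟩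
  have hj0 : 0 < j := hk0.trans hkj
  have hz := hm.even_eq_zero hk j
  have hz' : m' (k + 1, j) = 0 := by rw [hm', hz]; simp
  rw [row_split hk0 hj0 hn hz, row_split (m := m') hk0 hj0 hn hz',
    descProd_segPowM_congr (m' := m') (m := m),
    descProd_segPowM_congr (m' := m') (m := m), hm', hm']
  · obtain ⟨a, ha⟩ := Int.eq_ofNat_of_zero_le (hm.nonneg (k + 2) j)
    obtain ⟨b, hb⟩ := Int.eq_ofNat_of_zero_le (hm.nonneg k j)
    rw [ha, hb]
    have hB := mul_segPow_of_derivation_right (fgen_mul_seg_add_two hk hj hkj)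
      (seg_mul_seg_add_two hk hj hkj) a
    have hC := mul_segPow_of_smul_comm (fgen_mul_seg_start hk hj hkj) b
    rw [mul_prod_of_raise (x := fgen k) _ hB (seg_mul_segPow k j b) hC]
    · congr 2
      · rw [sub_eq_add_neg, zpow_add₀ q_ne_zero, zpow_neg, zpow_natCast, zpow_natCast, inv_pow]
      · simp
    · exact hm.mul_descProd_comm fun i h1 h2 h3 h4 h5 h6 =>
        fgen_mul_seg_comm hk h3 h4 h6 hkj (Or.inl (by omega))
    · exact hm.mul_descProd_comm fun i h1 h2 h3 h4 h5 h6 =>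
        fgen_mul_seg_comm hk h3 h4 h6 hkj (Or.inr (by omega))
  · intro i h1 h2
    rw [hm', if_neg (by omega), if_neg (by omega)]
    ring
  · intro i h1 h2
    rw [hm', if_neg (by omega), if_neg (by omega)]
    ring

theorem Ee_mul_row (hk : Odd k) (hk0 : 0 < k) (hm : IsTheta m) {j : ℤ} (hj : Odd j)
    (hkj : k < j) (hN : k + 2 ≤ N)
    (hm' : ∀ i, m' (i, j) = m (i, j) - (if i = k then 1 else 0) + (if i = k + 2 then 1 else 0)) :
    Ee k * row m N j = q ^ (m (k + 2, j) - m (k, j)) • (row m N j * Ee k) +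
      ((1 - q ^ 2) * qint (m (k + 2, j) + 1) * q ^ (1 + (m (k + 2, j) - m (k, j)))) •
        row m' N j := by
  obtain ⟨n, hn⟩ : ∃ n : ℕ, (N : ℤ) = k + 2 + n := ⟨(N - k - 2).toNat, by omega⟩
  have hj0 : 0 < j := hk0.trans hkj
  have hj2 : k + 2 ≤ j := by
    obtain ⟨a, rfl⟩ := hk
    obtain ⟨b, rfl⟩ := hj
    omega
  have hz := hm.even_eq_zero hk j
  have hz' : m' (k + 1, j) = 0 := by rw [hm', hz]; simp
  have hcomm {i : ℤ} (h3 : Odd i) (h6 : i ≤ j) (h : i ≠ k) (h' : i ≠ k + 2) :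
      Ee k * seg i j = seg i j * Ee k := by
    have e : ipAux k i - ipAux k (j + 2) = 0 := by
      unfold ipAux
      split_ifs <;> omega
    rw [Ee_mul_seg hk hk0 h3 hj h6 hj0 h, e, neg_zero, zpow_zero, one_smul]
  rw [row_split hk0 hj0 hn hz, row_split (m := m') hk0 hj0 hn hz',
    descProd_segPowM_congr (m' := m') (m := m),
    descProd_segPowM_congr (m' := m') (m := m), hm', hm']
  · obtain ⟨a, ha⟩ := Int.eq_ofNat_of_zero_le (hm.nonneg (k + 2) j)
    obtain ⟨b, hb⟩ := Int.eq_ofNat_of_zero_le (hm.nonneg k j)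
    rw [ha, hb]
    have hs : Ee k * seg (k + 2) j = q • (seg (k + 2) j * Ee k) := by
      have e : ipAux k (k + 2) - ipAux k (j + 2) = -1 := by
        unfold ipAux
        split_ifs <;> omega
      rw [Ee_mul_seg hk hk0 (odd_plus_two hk) hj hj2 hj0 (by omega), e, neg_neg, zpow_one]
    have hB := mul_segPow_of_smul_comm hs a
    have hd : seg k j * ((1 - q ^ 2) • seg (k + 2) j) =
        q⁻¹ • ((1 - q ^ 2) • seg (k + 2) j * seg k j) := by
      rw [mul_smul_comm, seg_mul_seg_add_two hk hj hkj, smul_mul_assoc, smul_comm]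
    have hC := mul_segPow_of_derivation_left (Ee_mul_seg_start hk hk0 hj hkj) hd
      (by rw [zpow_neg_one, ← zpow_neg_one, ← zpow_add₀ q_ne_zero]; norm_num) b
    rw [smul_mul_assoc, smul_smul] at hC
    rw [mul_prod_of_lower (x := Ee k) _ hB hC (segPow_mul_seg (k + 2) j a)]
    · congr 2
      · rw [sub_eq_add_neg, zpow_add₀ q_ne_zero, zpow_neg_one, zpow_neg, zpow_natCast,
          zpow_natCast, inv_pow]
      · rw [show 1 + ((a : ℤ) - b) = a + (1 - b) by ring, zpow_add₀ q_ne_zero (a : ℤ),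
          zpow_natCast]
        ring
      · simp
    · exact hm.mul_descProd_comm fun i h1 h2 h3 h4 h5 h6 => hcomm h3 h6 (by omega) (by omega)
    · exact hm.mul_descProd_comm fun i h1 h2 h3 h4 h5 h6 => hcomm h3 h6 (by omega) (by omega)
  · intro i h1 h2
    rw [hm', if_neg (by omega), if_neg (by omega)]
    ring
  · intro i h1 h2
    rw [hm', if_neg (by omega), if_neg (by omega)]
    ring

theorem fgen_mul_row_self (hk0 : 0 < k) (hm : IsTheta m) (hN : k ≤ N)
    (hm' : ∀ i, m' (i, k) = m (i, k) + (if i = k then 1 else 0)) :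
    fgen k * row m N k = qint (m (k, k) + 1) • row m' N k := by
  obtain ⟨n, hn⟩ : ∃ n : ℕ, (N : ℤ) = k + n := ⟨(N - k).toNat, by omega⟩
  have hz (i : ℤ) (h : k < i) : m (i, k) = 0 := hm.eq_zero (by omega)
  have hz' (i : ℤ) (h : k < i) : m' (i, k) = 0 := by
    rw [hm', hz i h, if_neg (by omega), add_zero]
  rw [row_split_diag hk0 hn hz, row_split_diag (m := m') hk0 hn hz',
    descProd_segPowM_congr (m' := m') (m := m), hm', if_pos rfl]
  · obtain ⟨b, hb⟩ := Int.eq_ofNat_of_zero_le (hm.nonneg k k)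
    rw [hb, ← mul_assoc, ← seg_self, seg_mul_segPow, smul_mul_assoc]
  · intro i h1 h2
    rw [hm', if_neg (by omega), add_zero]

theorem Ee_mul_row_self (hk : Odd k) (hk0 : 0 < k) (hm : IsTheta m) (hN : k ≤ N)
    (hm' : ∀ i, m' (i, k) = m (i, k) - (if i = k then 1 else 0)) :
    ∃ c : K, Ee k * row m N k = c • (row m N k * Ee k) + q ^ (1 - m (k, k)) • row m' N k := by
  obtain ⟨n, hn⟩ : ∃ n : ℕ, (N : ℤ) = k + n := ⟨(N - k).toNat, by omega⟩
  have hz (i : ℤ) (h : k < i) : m (i, k) = 0 := hm.eq_zero (by omega)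
  have hz' (i : ℤ) (h : k < i) : m' (i, k) = 0 := by
    rw [hm', hz i h, if_neg (by omega), sub_zero]
  rw [row_split_diag hk0 hn hz, row_split_diag (m := m') hk0 hn hz',
    descProd_segPowM_congr (m' := m') (m := m), hm', if_pos rfl]
  · obtain ⟨b, hb⟩ := Int.eq_ofNat_of_zero_le (hm.nonneg k k)
    obtain ⟨c, hc⟩ := hm.exists_mul_descProd_smul_comm (j := k) (hi := k - 1)
      (n := (N + k).toNat) hk hk0 (fun i h1 h2 _ => by omega)
    have hE := Ee_mul_fgen_self hk hk0
    rw [← seg_self] at hE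
    have hC := mul_segPow_of_derivation_left hE (c' := 1) (by rw [one_smul, mul_one, one_mul])
      (mul_one _) b
    rw [one_mul] at hC
    refine ⟨(q ^ (-2 : ℤ)) ^ b * c, ?_⟩
    rw [hb, ← mul_assoc, hC, add_mul, smul_mul_assoc, smul_mul_assoc, mul_assoc _ (Ee k), hc,
      mul_smul_comm, smul_smul, add_comm, mul_assoc]
  · intro i h1 h2
    rw [hm', if_neg (by omega), sub_zero]

theorem exists_Ee_mul_row (hk : Odd k) (hk0 : 0 < k) (hm : IsTheta m) {j : ℤ} (hj : j < k) :
    ∃ c : K, Ee k * row m N j = c • (row m N j * Ee k) :=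
  hm.exists_mul_descProd_smul_comm hk hk0 fun i _ _ h => by omega

theorem IsTheta.row_eq_one_of_even (hm : IsTheta m) {j : ℤ} (hj : ¬ Odd j) : row m N j = 1 :=
  row_eq_one (fun _ => hm.eq_zero fun h => hj h.2.1) N

end RowRules

theorem segPowM_of_neg {i j n : ℤ} (h : n < 0) : segPowM i j n = 0 := by
  simp [segPowM, segPow, h]

theorem descProd_eq_zero {A : Type*} [Ring A] {f : ℤ → A} {hi i : ℤ} {n : ℕ} (h1 : hi - n < i)
    (h2 : i ≤ hi) (h : f i = 0) : descProd f hi n = 0 := by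
  refine List.prod_eq_zero (List.mem_map.2 ⟨(hi - i).toNat, List.mem_range.2 (by omega), ?_⟩)
  rw [← h]
  congr 1
  omega

/-- The product defining `P_θ(m)`, taken over the box `[-N, N]²`. -/
def boxProd (m : MS) (N : ℕ) : U := descProd (row m N) N (2 * N + 1)

theorem Ptheta_eq_boxProd {m : MS} {N : ℕ}
    (hN : ∀ i j, m (i, j) ≠ 0 → i.natAbs ≤ N ∧ j.natAbs ≤ N)
    (hm : ∀ i j, m (i, j) ≠ 0 → Odd i ∧ Odd j ∧ -j ≤ i ∧ i ≤ j) :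
    Ptheta m = boxProd m N := by
  unfold Ptheta
  split_ifs with h
  · exact PthetaProd_eq_of_le (Finset.sup_le fun p hp =>
      max_le_iff.2 (hN p.1 p.2 (Finsupp.mem_support_iff.1 hp)))
  · obtain ⟨i, j, h0, h1⟩ : ∃ i j, m (i, j) ≠ 0 ∧ ¬ 0 < m (i, j) := by
      by_contra! hc
      exact h fun i j h0 =>
        ⟨(hm i j h0).1, (hm i j h0).2.1, (hm i j h0).2.2.1, (hm i j h0).2.2.2, hc i j h0⟩
    obtain ⟨hi, hj⟩ := hN i j h0
    refine (descProd_eq_zero (i := j) (by push_cast; omega) (by omega) ?_).symm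
    refine descProd_eq_zero (i := i) (by push_cast; omega) (by omega) ?_
    exact segPowM_of_neg (by omega)

theorem Ptheta_eq_zero {m : MS} {i j : ℤ} (h : m (i, j) < 0) : Ptheta m = 0 :=
  if_neg fun hm => absurd (hm.nonneg i j) (by omega)

theorem boxProd_split (m : MS) {N n : ℕ} {k : ℤ} (hk : 0 < k) (hn : (N : ℤ) = k + n) :
    boxProd m N =
      descProd (row m N) N (n + 1) * descProd (row m N) (k - 1) (N + k).toNat := by
  unfold boxProd
  rw [show 2 * N + 1 = n + 1 + (N + k).toNat by omega, descProd_add]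
  congr 2
  push_cast
  omega

theorem mul_boxProd {m : MS} {m' : ℤ → MS} {N n : ℕ} {k : ℤ} {x : U} {c d : ℤ → K} (hk : 0 < k)
    (hn : (N : ℤ) = k + n)
    (hx : ∀ j, k ≤ j → x * row m N j = c j • (row m N j * x) + d j • row (m' j) N j)
    (hm : ∀ l i j, j ≠ l → m' l (i, j) = m (i, j)) :
    x * boxProd m N =
      (∏ b ∈ Finset.range (n + 1), c (N - b)) • (descProd (row m N) N (n + 1) *
        (x * descProd (row m N) (k - 1) (N + k).toNat)) +
      ∑ a ∈ Finset.range (n + 1), (d (N - a) * ∏ b ∈ Finset.range a, c (N - b)) •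
        boxProd (m' (N - a)) N := by
  have hw (l j : ℤ) (h : j ≠ l) : row (m' l) N j = row m N j := row_congr (fun i => hm l i j h) N
  rw [boxProd_split m hk hn, ← mul_assoc, mul_descProd_eq_sum (w' := fun l j => row (m' l) N j)
    (fun j h1 _ => hx j (by push_cast at h1; omega)) hw, add_mul, Finset.sum_mul, smul_mul_assoc,
    mul_assoc]
  congr 1
  refine Finset.sum_congr rfl fun a ha => ?_
  have := Finset.mem_range.1 ha
  rw [boxProd_split (m' _) hk hn, smul_mul_assoc]
  congr 2
  exact descProd_congr fun i _ h => (hw _ _ (by omega)).symm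

theorem finsum_eq_sum_range_sub {M : Type*} [AddCommMonoid M] {G : ℤ → M} {N : ℤ} {n : ℕ}
    (hG : ∀ l, l ≤ N - n ∨ N < l → G l = 0) :
    ∑ᶠ l, G l = ∑ a ∈ Finset.range n, G (N - a) := by
  have hinj : Function.Injective fun a : ℕ => N - (a : ℤ) := fun a b h => by
    simp only at h
    omega
  rw [finsum_eq_finsetSum_of_support_subset (s := (Finset.range n).map ⟨_, hinj⟩), Finset.sum_map]
  · rfl
  · intro l hl
    have h : ¬ (l ≤ N - n ∨ N < l) := fun h => hl (hG l h)
    simp only [Finset.coe_map, Function.Embedding.coeFn_mk, Set.mem_image, Finset.mem_coe,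
      Finset.mem_range]
    exact ⟨(N - l).toNat, by omega, by omega⟩

theorem prod_q_zpow (f : ℕ → ℤ) (s : Finset ℕ) : ∏ b ∈ s, q ^ f b = q ^ ∑ b ∈ s, f b := by
  induction s using Finset.induction_on with
  | empty => simp
  | insert a s ha ih => rw [Finset.prod_insert ha, Finset.sum_insert ha, ih, zpow_add₀ q_ne_zero]

theorem smul_zero_Vt (c : K) : c • (0 : Vt) = 0 := by
  rw [← smul_one_smul U c (0 : Vt), smul_zero]

theorem zero_smul_Vt (x : Vt) : (0 : K) • x = 0 := by
  rw [← smul_one_smul U (0 : K) x, zero_smul, zero_smul]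

theorem Ee_smul_phi {k : ℤ} (hk : Odd k) : Ee k • phi = 0 := by
  rw [phi, ← Submodule.Quotient.mk_smul, Submodule.Quotient.mk_eq_zero, smul_eq_mul, mul_one]
  exact Ideal.subset_span ⟨k, hk, Or.inl rfl⟩

/-- The exponent `m_{k+2,l} - m_{k,l}` attached to an odd `l > k`. -/
def rowExp (m : MS) (k l : ℤ) : ℤ := if Odd l ∧ k < l then m (k + 2, l) - m (k, l) else 0

theorem rowExp_eq_zero {m : MS} {N : ℕ} (hN : bound m ≤ N) {k l : ℤ} (h : (N : ℤ) < l) :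
    rowExp m k l = 0 := by
  have hz (i : ℤ) : m (i, l) = 0 := by
    by_contra h0
    have := (natAbs_le_bound h0).2
    omega
  simp [rowExp, hz]

theorem finsum_rowExp {m : MS} {N a : ℕ} (hN : bound m ≤ N) {k : ℤ} (h : k ≤ N - a)
    {p : ℤ → Prop} [DecidablePred p] (hp : ∀ l, p l ↔ (N : ℤ) - a < l) :
    (∑ᶠ l : ℤ, if Odd l ∧ p l then m (k + 2, l) - m (k, l) else 0) =
      ∑ b ∈ Finset.range a, rowExp m k (N - b) := by
  have e (l : ℤ) (hl : (N : ℤ) - a < l) :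
      (if Odd l ∧ p l then m (k + 2, l) - m (k, l) else 0) = rowExp m k l := by
    have h1 : p l := (hp l).2 hl
    have h2 : k < l := by omega
    simp [rowExp, h1, h2]
  rw [finsum_eq_sum_range_sub (N := N) (n := a)]
  · refine Finset.sum_congr rfl fun b hb => e _ ?_
    have := Finset.mem_range.1 hb
    omega
  · rintro l (hl | hl)
    · exact if_neg fun h' => absurd ((hp l).1 h'.2) (by omega)
    · rw [e l (by omega), rowExp_eq_zero hN hl]

theorem sg_apply (i j i' j' : ℤ) : sg i j (i', j') = if i' = i ∧ j' = j then 1 else 0 := by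
  simp [sg, Finsupp.single_apply, eq_comm]

section Action

variable {k : ℤ} {m : MS} {N n : ℕ}

theorem fgen_mul_boxProd (hk : Odd k) (hk0 : 0 < k) (hm : IsTheta m) (hN : k + 2 ≤ N)
    (hn : (N : ℤ) = k + n) :
    fgen k * boxProd m N = ∑ a ∈ Finset.range (n + 1),
      ((if Odd (N - a : ℤ) then qint (m (k, N - a) + 1) else 0) *
        q ^ ∑ b ∈ Finset.range a, rowExp m k (N - b)) •
        boxProd (m - (if (N - a : ℤ) ≠ k then sg (k + 2) (N - a) else 0) + sg k (N - a)) N := by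
  have h0 : ∏ b ∈ Finset.range (n + 1),
      (if (N - b : ℤ) = k then (0 : K) else q ^ rowExp m k (N - b)) = 0 :=
    Finset.prod_eq_zero (i := n) (by simp) (if_pos (by omega))
  rw [mul_boxProd (m' := fun l => m - (if l ≠ k then sg (k + 2) l else 0) + sg k l)
    (c := fun j => if j = k then 0 else q ^ rowExp m k j)
    (d := fun j => if Odd j then qint (m (k, j) + 1) else 0) hk0 hn, h0,
    zero_smul, zero_add]
  · refine Finset.sum_congr rfl fun a ha => ?_
    have := Finset.mem_range.1 ha
    rw [← prod_q_zpow]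
    congr 2
    refine Finset.prod_congr rfl fun b hb => if_neg ?_
    have := Finset.mem_range.1 hb
    omega
  · intro j hj
    rcases hj.eq_or_lt with rfl | hj
    · rw [if_pos rfl, zero_smul, zero_add, if_pos hk]
      refine fgen_mul_row_self hk0 hm (by omega) fun i => ?_
      simp [sg_apply]
    · rw [if_neg hj.ne']
      by_cases ho : Odd j
      · rw [if_pos ho, rowExp, if_pos ⟨ho, hj⟩]
        refine fgen_mul_row hk hk0 hm ho hj hN fun i => ?_
        simp [sg_apply, hj.ne']
        ring
      · rw [if_neg ho, rowExp, if_neg fun h => ho h.1, hm.row_eq_one_of_even ho]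
        simp
  · intro l i j h
    by_cases hl : l = k <;> simp [sg_apply, h, hl]
    all_goals omega

theorem Ee_mul_boxProd_smul_phi (hk : Odd k) (hk0 : 0 < k) (hm : IsTheta m) (hN : k + 2 ≤ N)
    (hn : (N : ℤ) = k + n) :
    (Ee k * boxProd m N) • phi = (∑ a ∈ Finset.range n,
      (if Odd (N - a : ℤ) then (1 - q ^ 2) * qint (m (k + 2, N - a) + 1) *
        q ^ (1 + ∑ b ∈ Finset.range (a + 1), rowExp m k (N - b)) else 0) •
        (boxProd (m - sg k (N - a) + sg (k + 2) (N - a)) N • phi)) +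
      q ^ (1 + (∑ b ∈ Finset.range n, rowExp m k (N - b)) - m (k, k)) •
        (boxProd (m - sg k k) N • phi) := by
  obtain ⟨ck, hck⟩ := Ee_mul_row_self (m' := m - sg k k) (N := N) hk hk0 hm (by omega)
    (fun i => by simp [sg_apply])
  obtain ⟨c', hc'⟩ := exists_mul_descProd_smul_comm (f := row m N) (hi := k - 1)
    (n := (N + k).toNat) (x := Ee k) fun j _ h => exists_Ee_mul_row hk hk0 hm (by omega)
  have hkill : (Ee k * descProd (row m N) (k - 1) (N + k).toNat) • phi = 0 := by
    rw [hc', smul_assoc, mul_smul, Ee_smul_phi hk, smul_zero, smul_zero_Vt]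
  have hprod {a : ℕ} (ha : a ≤ n) :
      ∏ b ∈ Finset.range a, (if (N - b : ℤ) = k then ck else q ^ rowExp m k (N - b)) =
        q ^ ∑ b ∈ Finset.range a, rowExp m k (N - b) := by
    rw [← prod_q_zpow]
    refine Finset.prod_congr rfl fun b hb => if_neg ?_
    have := Finset.mem_range.1 hb
    omega
  rw [mul_boxProd (m' := fun l => if l = k then m - sg k k else m - sg k l + sg (k + 2) l)
    (c := fun j => if j = k then ck else q ^ rowExp m k j)
    (d := fun j => if j = k then q ^ (1 - m (k, k)) else
      if Odd j then (1 - q ^ 2) * qint (m (k + 2, j) + 1) * q ^ (1 + rowExp m k j) else 0) hk0 hn,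
    add_smul, smul_assoc, mul_smul (descProd _ _ _), hkill, smul_zero, smul_zero_Vt, zero_add,
    Finset.sum_smul, Finset.sum_range_succ]
  · congr 1
    · refine Finset.sum_congr rfl fun a ha => ?_
      have := Finset.mem_range.1 ha
      have hne : (N - a : ℤ) ≠ k := by omega
      rw [hprod (by omega), if_neg hne, if_neg hne, smul_assoc]
      congr 1
      split_ifs
      · rw [Finset.sum_range_succ, add_comm (∑ b ∈ _, _), ← add_assoc,
            zpow_add₀ q_ne_zero _ (∑ b ∈ _, _)]
        ring
      · simp
    · have e : (N - n : ℤ) = k := by omega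
      rw [hprod le_rfl, e, if_pos rfl, if_pos rfl, smul_assoc, ← zpow_add₀ q_ne_zero]
      congr 2
      ring
  · intro j hj
    rcases hj.eq_or_lt with rfl | hj
    · simpa using hck
    · rw [if_neg hj.ne', if_neg hj.ne', if_neg hj.ne']
      by_cases ho : Odd j
      · rw [if_pos ho, rowExp, if_pos ⟨ho, hj⟩]
        refine Ee_mul_row hk hk0 hm ho hj hN fun i => ?_
        simp [sg_apply]
      · rw [if_neg ho, rowExp, if_neg fun h => ho h.1, hm.row_eq_one_of_even ho]
        simp
  · intro l i j h
    by_cases hl : l = k <;> simp [sg_apply, h, hl]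
    all_goals omega

theorem IsTheta.Ptheta_eq_boxProd_of_ne (hm : IsTheta m) (hk : Odd k) (hk0 : 0 < k)
    (hN : k + 2 ≤ N) (hb : bound m ≤ N) {m' : MS} {l : ℤ} (hl : Odd l) (hkl : k ≤ l) (hlN : l ≤ N)
    (h : ∀ i j, m' (i, j) ≠ m (i, j) → j = l ∧ (i = k ∨ i = k + 2 ∧ k < l)) :
    Ptheta m' = boxProd m' N := by
  refine Ptheta_eq_boxProd (fun i j h0 => ?_) (fun i j h0 => ?_)
  · by_cases he : m' (i, j) = m (i, j)
    · have := natAbs_le_bound (he ▸ h0)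
      omega
    · have := h i j he
      omega
  · by_cases he : m' (i, j) = m (i, j)
    · obtain ⟨h1, h2, h3, h4, -⟩ := hm i j (he ▸ h0)
      exact ⟨h1, h2, h3, h4⟩
    · obtain ⟨rfl, rfl | ⟨rfl, h2⟩⟩ := h i j he
      · exact ⟨hk, hl, by omega, hkl⟩
      · refine ⟨odd_plus_two hk, hl, by omega, ?_⟩
        obtain ⟨a, rfl⟩ := hk
        obtain ⟨b, rfl⟩ := hl
        omega

end Action

/-- Theorem 3.23 of Enomoto–Kashiwara: the actions of `E_k` and `F_k` (for `k > 0`)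
on `P_θ(m)φ̃`. -/
theorem E_F_pos_action_on_PBW (k : ℤ) (hk : Odd k) (hkpos : 0 < k)
    (m : MS) (hm : IsTheta m) :
    ((Ee k * Ptheta m) • phi =
      (∑ᶠ l : ℤ, if Odd l ∧ k < l then
        ((1 - q ^ 2) * qint (m (k + 2, l) + 1) *
          q ^ (1 + ∑ᶠ l' : ℤ, if Odd l' ∧ l ≤ l' then m (k + 2, l') - m (k, l') else 0)) •
          (Ptheta (m - sg k l + sg (k + 2) l) • phi)
       else 0)
      + (q ^ (1 + (∑ᶠ l' : ℤ, if Odd l' ∧ k < l' then m (k + 2, l') - m (k, l') else 0)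
              - m (k, k))) •
          (Ptheta (m - sg k k) • phi)) ∧
    ((fgen k * Ptheta m) • phi =
      ∑ᶠ l : ℤ, if Odd l ∧ k ≤ l then
        (qint (m (k, l) + 1) *
          q ^ (∑ᶠ l' : ℤ, if Odd l' ∧ l < l' then m (k + 2, l') - m (k, l') else 0)) •
          (Ptheta (m - (if l ≠ k then sg (k + 2) l else 0) + sg k l) • phi)
       else 0) := by
  obtain ⟨N, hb, hN⟩ : ∃ N : ℕ, bound m ≤ N ∧ k + 2 ≤ N :=
    ⟨bound m + (k + 2).toNat, by omega, by omega⟩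
  obtain ⟨n, hn⟩ : ∃ n : ℕ, (N : ℤ) = k + n := ⟨(N - k).toNat, by omega⟩
  have hz {i l : ℤ} (hl : (N : ℤ) < l) : m (i, l) = 0 := by
    by_contra h0
    have := (natAbs_le_bound h0).2
    omega
  have hP : Ptheta m = boxProd m N :=
    hm.Ptheta_eq_boxProd_of_ne hk hkpos hN hb hk le_rfl (by omega) fun i j h => absurd rfl h
  constructor
  · rw [hP, Ee_mul_boxProd_smul_phi hk hkpos hm hN hn,
      finsum_rowExp (k := k) (p := fun l => k < l) (a := n) hb (by omega) (by intro l; omega),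
      finsum_eq_sum_range_sub (N := N) (n := n)]
    · congr 1
      · refine Finset.sum_congr rfl fun a ha => ?_
        have := Finset.mem_range.1 ha
        by_cases ho : Odd (N - a : ℤ)
        · rw [if_pos ho, if_pos (show Odd (N - a : ℤ) ∧ k < N - a from ⟨ho, by omega⟩),
            finsum_rowExp (k := k) (p := fun l => (N - a : ℤ) ≤ l) (a := a + 1) hb (by omega)
              (by intro l; push_cast; omega),
            hm.Ptheta_eq_boxProd_of_ne hk hkpos hN hb ho (by omega) (by omega)]
          intro i j h
          simp [sg_apply] at h
          by_contra
          apply h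
          rw [if_neg (by omega), if_neg (by omega)]
          simp
        · rw [if_neg ho, if_neg (show ¬ (Odd (N - a : ℤ) ∧ k < N - a) from fun h => ho h.1),
            zero_smul_Vt]
      · rw [hm.Ptheta_eq_boxProd_of_ne hk hkpos hN hb hk le_rfl (by omega)]
        intro i j h
        simp [sg_apply] at h
        omega
    · rintro l (hl | hl)
      · exact if_neg fun h => by omega
      · split_ifs with h
        · rw [Ptheta_eq_zero (i := k) (j := l), zero_smul, smul_zero_Vt]
          simp [sg_apply, hz hl]
        · rfl
  · rw [hP, fgen_mul_boxProd hk hkpos hm hN hn, Finset.sum_smul,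
      finsum_eq_sum_range_sub (N := N) (n := n + 1)]
    · refine Finset.sum_congr rfl fun a ha => ?_
      have := Finset.mem_range.1 ha
      by_cases ho : Odd (N - a : ℤ)
      · rw [if_pos ho, if_pos (show Odd (N - a : ℤ) ∧ k ≤ N - a from ⟨ho, by omega⟩),
          finsum_rowExp (k := k) (p := fun l => (N - a : ℤ) < l) (a := a) hb (by omega)
            (by intro l; rfl),
          hm.Ptheta_eq_boxProd_of_ne hk hkpos hN hb ho (by omega) (by omega), smul_assoc]
        intro i j h
        by_contra
        apply h
        split_ifs <;> simp [sg_apply] <;> omega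
      · rw [if_neg ho, if_neg (show ¬ (Odd (N - a : ℤ) ∧ k ≤ N - a) from fun h => ho h.1),
          zero_mul, zero_smul, zero_smul]
    · rintro l (hl | hl)
      · exact if_neg fun h => by push_cast at hl; omega
      · split_ifs with h h'
        · rw [Ptheta_eq_zero (i := k + 2) (j := l), zero_smul, smul_zero_Vt]
          simp [sg_apply, hz hl]
        · omega
        · rfl

end
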